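/- Suppose in addition that the density family q is MTP₂ (totally positive of order 2), i.e. q(x, θ)·q(x', θ') ≥ q(x', θ)·q(x, θ') for all x ≤ x' and θ ≤ θ'. Let μ and μ' be probability measures on ℝ possessing densities p and p' with respect to a common σ-finite measure ν such that μ ≤_lr μ' in the likelihood ratio order, i.e. p(θ)·p'(θ') ≥ p(θ')·p'(θ) for all θ ≤ θ'. Then for every n ≥ 1 the reservation levels of the exponential-utility Bayesian house selling problem satisfy x^γ_n(μ) ≤ x^γ_n(μ'); that is, the reservation levels are increasing in the information in the likelihood ratio order. -/

import Mathlib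

open MeasureTheory

/-- The distribution `Q_μ` of the next offer given the conditional distribution `μ` of the
unknown parameter: the measure on `ℝ` with `λ`-density `x ↦ ∫ q(x,θ) μ(dθ)`. -/
noncomputable def offerMeasure (lam : Measure ℝ) (q : ℝ → ℝ → ℝ) (μ : Measure ℝ) :
    Measure ℝ :=
  lam.withDensity fun x => ENNReal.ofReal (∫ θ, q x θ ∂μ)

/-- The Bayes updating operator `Φ(x, μ)`: the measure with `μ`-density
`θ ↦ q(x,θ) / ∫ q(x,θ') μ(dθ')` when the denominator is positive, and `μ` otherwise. -/
noncomputable def bayesUpdate (q : ℝ → ℝ → ℝ) (x : ℝ) (μ : Measure ℝ) : Measure ℝ :=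
  if 0 < ∫ θ, q x θ ∂μ then
    μ.withDensity fun θ => ENNReal.ofReal (q x θ / ∫ θ', q x θ' ∂μ)
  else μ

/-- The reservation levels of the exponential-utility Bayesian house selling problem;
`resLevel lam q c γ n μ` is the reservation level `x^γ_{n+1}(μ)` with `n+1` remaining
stages:  `x^γ_1(μ) = −c + (1/γ)·ln ∫ e^{γx} Q_μ(dx)` and
`x^γ_{n+1}(μ) = −c + (1/γ)·ln ∫ e^{γ·max{x, x^γ_n(Φ(x,μ))}} Q_μ(dx)`. -/
noncomputable def resLevel (lam : Measure ℝ) (q : ℝ → ℝ → ℝ) (c γ : ℝ) :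
    ℕ → Measure ℝ → ℝ
  | 0, μ => -c + (1 / γ) * Real.log (∫ x, Real.exp (γ * x) ∂(offerMeasure lam q μ))
  | n + 1, μ => -c + (1 / γ) * Real.log (∫ x,
      Real.exp (γ * max x (resLevel lam q c γ n (bayesUpdate q x μ)))
        ∂(offerMeasure lam q μ))

/-- Two products of integrals are ordered if the symmetrized products of integrands are. -/
theorem integral_mul_integral_le_of_symmetrization {α : Type*} [MeasurableSpace α]
    {lam : Measure α} [SFinite lam] {f g f' g' : α → ℝ} (hf : Integrable f lam)
    (hg : Integrable g lam) (hf' : Integrable f' lam) (hg' : Integrable g' lam)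
    (h : ∀ᵐ z ∂lam.prod lam,
      f z.1 * g z.2 + f z.2 * g z.1 ≤ f' z.1 * g' z.2 + f' z.2 * g' z.1) :
    (∫ x, f x ∂lam) * (∫ x, g x ∂lam) ≤ (∫ x, f' x ∂lam) * (∫ x, g' x ∂lam) := by
  have hsum : ∀ u v : α → ℝ, Integrable u lam → Integrable v lam →
      Integrable (fun z : α × α => u z.1 * v z.2 + u z.2 * v z.1) (lam.prod lam) ∧
      ∫ z : α × α, (u z.1 * v z.2 + u z.2 * v z.1) ∂lam.prod lam =
        2 * ((∫ x, u x ∂lam) * ∫ x, v x ∂lam) := by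
    intro u v hu hv
    have h1 : Integrable (fun z : α × α => u z.1 * v z.2) (lam.prod lam) := hu.mul_prod hv
    have h2 : Integrable (fun z : α × α => u z.2 * v z.1) (lam.prod lam) := h1.swap
    refine ⟨h1.add h2, ?_⟩
    rw [integral_add h1 h2, ← integral_prod_mul u v, two_mul]
    exact congrArg _ (integral_prod_swap fun z : α × α => u z.1 * v z.2)
  have hle := integral_mono_ae (hsum f g hf hg).1 (hsum f' g' hf' hg').1 h
  rw [(hsum f g hf hg).2, (hsum f' g' hf' hg').2] at hle
  linarith

theorem integral_withDensity_ofReal_mul {α : Type*} [MeasurableSpace α] {ν : Measure α}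
    {p : α → ℝ} (hp : AEMeasurable p ν) (hpnn : ∀ θ, 0 ≤ p θ) (u : α → ℝ) :
    ∫ θ, u θ ∂ν.withDensity (fun θ => ENNReal.ofReal (p θ)) = ∫ θ, p θ * u θ ∂ν := by
  rw [integral_withDensity_eq_integral_toReal_smul₀ hp.ennreal_ofReal
    (ae_of_all _ fun _ => ENNReal.ofReal_lt_top)]
  simp [ENNReal.toReal_ofReal, hpnn]

theorem integrable_withDensity_ofReal_iff {α : Type*} [MeasurableSpace α] {ν : Measure α}
    {p : α → ℝ} (hp : Measurable p) (hpnn : ∀ θ, 0 ≤ p θ) (u : α → ℝ) :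
    Integrable u (ν.withDensity fun θ => ENNReal.ofReal (p θ)) ↔
      Integrable (fun θ => p θ * u θ) ν := by
  rw [integrable_withDensity_iff_integrable_smul' hp.ennreal_ofReal
    (ae_of_all _ fun _ => ENNReal.ofReal_lt_top)]
  simp [ENNReal.toReal_ofReal, hpnn]

/-- The basic composition formula: a likelihood ratio ordered pair of densities integrates
a totally positive pair of functions to a nonnegative determinant. -/
theorem integral_mul_integral_le_of_likelihoodRatio {ν : Measure ℝ} [SigmaFinite ν]
    {p p' u v : ℝ → ℝ}
    (hlr : ∀ θ θ', θ ≤ θ' → p θ' * p' θ ≤ p θ * p' θ')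
    (huv : ∀ θ θ', θ ≤ θ' → v θ * u θ' ≤ u θ * v θ')
    (hu : Integrable (fun θ => p θ * u θ) ν) (hv : Integrable (fun θ => p θ * v θ) ν)
    (hu' : Integrable (fun θ => p' θ * u θ) ν) (hv' : Integrable (fun θ => p' θ * v θ) ν) :
    (∫ θ, p θ * v θ ∂ν) * (∫ θ, p' θ * u θ ∂ν) ≤
      (∫ θ, p θ * u θ ∂ν) * (∫ θ, p' θ * v θ ∂ν) := by
  refine integral_mul_integral_le_of_symmetrization hv hu' hu hv' (ae_of_all _ fun z => ?_)
  obtain ⟨a, b⟩ := z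
  dsimp only
  rcases le_total a b with hab | hab
  · nlinarith [mul_nonneg (sub_nonneg.2 (hlr a b hab)) (sub_nonneg.2 (huv a b hab))]
  · nlinarith [mul_nonneg (sub_nonneg.2 (hlr b a hab)) (sub_nonneg.2 (huv b a hab))]

theorem integrable_uncurry_prod_of_density {lam : Measure ℝ} [SigmaFinite lam]
    {q : ℝ → ℝ → ℝ} (hq : Measurable (Function.uncurry q)) (hqnn : ∀ x θ, 0 ≤ q x θ)
    (hqdens : ∀ θ, ∫ x, q x θ ∂lam = 1) (μ : Measure ℝ) [IsProbabilityMeasure μ] :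
    Integrable (Function.uncurry q) (lam.prod μ) := by
  refine (integrable_prod_iff' hq.aestronglyMeasurable).2
    ⟨ae_of_all _ fun θ => integrable_of_integral_eq_one (hqdens θ), ?_⟩
  simp [Function.uncurry, abs_of_nonneg (hqnn _ _), hqdens]

theorem integral_integral_eq_one_of_density {lam : Measure ℝ} [SigmaFinite lam]
    {q : ℝ → ℝ → ℝ} (hq : Measurable (Function.uncurry q)) (hqnn : ∀ x θ, 0 ≤ q x θ)
    (hqdens : ∀ θ, ∫ x, q x θ ∂lam = 1) (μ : Measure ℝ) [IsProbabilityMeasure μ] :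
    ∫ x, ∫ θ, q x θ ∂μ ∂lam = 1 := by
  rw [integral_integral_swap (integrable_uncurry_prod_of_density hq hqnn hqdens μ)]
  simp [hqdens]

/-- Bayes updating multiplies the density of the parameter by the normalized likelihood. -/
theorem bayesUpdate_withDensity {ν : Measure ℝ} {q : ℝ → ℝ → ℝ} {p : ℝ → ℝ}
    (hq : Measurable (Function.uncurry q)) (hp : Measurable p) (hpnn : ∀ θ, 0 ≤ p θ) {x : ℝ}
    {μ : Measure ℝ} (hμ : μ = ν.withDensity fun θ => ENNReal.ofReal (p θ))
    (hx : 0 < ∫ θ, q x θ ∂μ) :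
    bayesUpdate q x μ =
      ν.withDensity fun θ => ENNReal.ofReal (p θ * (q x θ / ∫ θ', q x θ' ∂μ)) := by
  rw [bayesUpdate, if_pos hx]
  nth_rewrite 1 [hμ]
  rw [← withDensity_mul _ hp.ennreal_ofReal (hq.of_uncurry_left.div_const _).ennreal_ofReal]
  congr 1
  ext θ
  rw [Pi.mul_apply, ENNReal.ofReal_mul (hpnn θ)]

theorem isProbabilityMeasure_bayesUpdate {q : ℝ → ℝ → ℝ} (hqnn : ∀ x θ, 0 ≤ q x θ)
    (x : ℝ) (μ : Measure ℝ) [IsProbabilityMeasure μ] :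
    IsProbabilityMeasure (bayesUpdate q x μ) := by
  rw [bayesUpdate]
  split_ifs with hx
  · have hi : Integrable (q x) μ := by
      by_contra h
      simp [integral_undef h] at hx
    constructor
    rw [withDensity_apply _ MeasurableSet.univ, Measure.restrict_univ,
      ← ofReal_integral_eq_lintegral_ofReal (hi.div_const _)
        (ae_of_all _ fun θ => div_nonneg (hqnn _ _) hx.le),
      integral_div, div_self hx.ne', ENNReal.ofReal_one]
  · assumption

/-- Comparison of the certainty equivalents of payoffs `G`, `G'` that dominate the offer and
are ordered on the offers of positive predictive density. -/
theorem log_integral_offerMeasure_le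
    {lam : Measure ℝ} [SigmaFinite lam] {m M : ℝ}
    {q : ℝ → ℝ → ℝ} (hq : Measurable (Function.uncurry q))
    (hqnn : ∀ x θ, 0 ≤ q x θ)
    (hqdens : ∀ θ, ∫ x, q x θ ∂lam = 1)
    (hqsupp : ∀ x θ, x ∉ Set.Icc m M → q x θ = 0)
    {γ : ℝ} (hγ : γ < 0)
    (hMTP2 : ∀ x x' θ θ', x ≤ x' → θ ≤ θ' → q x' θ * q x θ' ≤ q x θ * q x' θ')
    {ν : Measure ℝ} [SigmaFinite ν]
    {p p' : ℝ → ℝ} (hp : Measurable p) (hp' : Measurable p')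
    (hpnn : ∀ θ, 0 ≤ p θ) (hp'nn : ∀ θ, 0 ≤ p' θ)
    {μ μ' : Measure ℝ} [IsProbabilityMeasure μ] [IsProbabilityMeasure μ']
    (hμ : μ = ν.withDensity fun θ => ENNReal.ofReal (p θ))
    (hμ' : μ' = ν.withDensity fun θ => ENNReal.ofReal (p' θ))
    (hlr : ∀ θ θ', θ ≤ θ' → p θ' * p' θ ≤ p θ * p' θ')
    {G G' : ℝ → ℝ} (hG : Measurable G) (hG' : Measurable G')
    (hGx : ∀ x, x ≤ G x) (hGx' : ∀ x, x ≤ G' x)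
    (hGG' : ∀ x x', x ≤ x' → 0 < ∫ θ, q x θ ∂μ → 0 < ∫ θ, q x' θ ∂μ' → G x ≤ G' x') :
    (1 / γ) * Real.log (∫ x, Real.exp (γ * G x) ∂(offerMeasure lam q μ)) ≤
      (1 / γ) * Real.log (∫ x, Real.exp (γ * G' x) ∂(offerMeasure lam q μ')) := by
  have key : ∀ (κ : Measure ℝ) [IsProbabilityMeasure κ] (H : ℝ → ℝ), Measurable H →
      (∀ x, x ≤ H x) →
      Integrable (fun x => (∫ θ, q x θ ∂κ) * Real.exp (γ * H x)) lam := by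
    intro κ _ H hH hHx
    have hf := (integrable_uncurry_prod_of_density hq hqnn hqdens κ).integral_prod_left
    refine (hf.mul_const (Real.exp (γ * m))).mono'
      (hf.aestronglyMeasurable.mul (by fun_prop)) (ae_of_all _ fun x => ?_)
    have hfx : 0 ≤ ∫ θ, q x θ ∂κ := integral_nonneg (hqnn x)
    rw [Real.norm_of_nonneg (mul_nonneg hfx (Real.exp_nonneg _))]
    by_cases hx : x ∈ Set.Icc m M
    · exact mul_le_mul_of_nonneg_left (Real.exp_le_exp.2
        (mul_le_mul_of_nonpos_left (hx.1.trans (hHx x)) hγ.le)) hfx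
    · simp [hqsupp x _ hx]
  have I := integrable_uncurry_prod_of_density hq hqnn hqdens μ
  have I' := integrable_uncurry_prod_of_density hq hqnn hqdens μ'
  have hf : Integrable (fun x => ∫ θ, q x θ ∂μ) lam := I.integral_prod_left
  have hf' : Integrable (fun x => ∫ θ, q x θ ∂μ') lam := I'.integral_prod_left
  have hfnn : ∀ x, 0 ≤ ∫ θ, q x θ ∂μ := fun x => integral_nonneg (hqnn x)
  have hfnn' : ∀ x, 0 ≤ ∫ θ, q x θ ∂μ' := fun x => integral_nonneg (hqnn x)
  have hg := key μ G hG hGx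
  have hg' := key μ' G' hG' hGx'
  have hone := integral_integral_eq_one_of_density hq hqnn hqdens μ
  have hone' := integral_integral_eq_one_of_density hq hqnn hqdens μ'
  have hoff : offerMeasure lam q μ =
    lam.withDensity fun x => ENNReal.ofReal (∫ θ, q x θ ∂μ) := rfl
  have hoff' : offerMeasure lam q μ' =
    lam.withDensity fun x => ENNReal.ofReal (∫ θ, q x θ ∂μ') := rfl
  have hle : ∀ x x', x ≤ x' → Integrable (q x) μ → Integrable (q x') μ →
      Integrable (q x) μ' → Integrable (q x') μ' →
      (∫ θ, q x' θ ∂μ) * (∫ θ, q x θ ∂μ') ≤ (∫ θ, q x θ ∂μ) * (∫ θ, q x' θ ∂μ') := by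
    intro x x' hxx' h1 h2 h3 h4
    rw [hμ, integrable_withDensity_ofReal_iff hp hpnn] at h1 h2
    rw [hμ', integrable_withDensity_ofReal_iff hp' hp'nn] at h3 h4
    rw [hμ, hμ']
    simp only [integral_withDensity_ofReal_mul hp.aemeasurable hpnn,
      integral_withDensity_ofReal_mul hp'.aemeasurable hp'nn]
    exact integral_mul_integral_le_of_likelihoodRatio hlr
      (fun θ θ' h => hMTP2 x x' θ θ' hxx' h) h1 h2 h3 h4
  have hpos : 0 < ∫ x, (∫ θ, q x θ ∂μ') * Real.exp (γ * G' x) ∂lam := by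
    have hprob : IsProbabilityMeasure (offerMeasure lam q μ') := by
      constructor
      rw [hoff', withDensity_apply _ MeasurableSet.univ, Measure.restrict_univ,
        ← ofReal_integral_eq_lintegral_ofReal hf' (ae_of_all _ hfnn'), hone',
        ENNReal.ofReal_one]
    rw [← integral_withDensity_ofReal_mul hf'.aestronglyMeasurable.aemeasurable hfnn',
      ← hoff']
    refine integral_exp_pos ?_
    have hfm : Measurable fun x => ∫ θ, q x θ ∂μ' :=
      hq.stronglyMeasurable.integral_prod_right.measurable
    rw [hoff', integrable_withDensity_ofReal_iff hfm hfnn']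
    exact hg'
  have hlt : ∀ x x', x ≤ x' → 0 < ∫ θ, q x θ ∂μ → 0 < ∫ θ, q x' θ ∂μ' →
      Real.exp (γ * G' x') ≤ Real.exp (γ * G x) := fun x x' h h1 h2 =>
    Real.exp_le_exp.2 (mul_le_mul_of_nonpos_left (hGG' x x' h h1 h2) hγ.le)
  have hsymm : ∀ x x', x ≤ x' →
      (∫ θ, q x' θ ∂μ) * (∫ θ, q x θ ∂μ') ≤ (∫ θ, q x θ ∂μ) * (∫ θ, q x' θ ∂μ') →
      0 ≤ (∫ θ, q x θ ∂μ) * (∫ θ, q x' θ ∂μ') *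
          (Real.exp (γ * G x) - Real.exp (γ * G' x')) +
        (∫ θ, q x' θ ∂μ) * (∫ θ, q x θ ∂μ') *
          (Real.exp (γ * G x') - Real.exp (γ * G' x)) := by
    intro x x' hxx' hdet
    have hA : ∀ y y', y ≤ y' → 0 < (∫ θ, q y θ ∂μ) * (∫ θ, q y' θ ∂μ') →
        Real.exp (γ * G' y') ≤ Real.exp (γ * G y) := fun y y' hy h =>
      hlt y y' hy (pos_of_mul_pos_left h (hfnn' y')) (pos_of_mul_pos_right h (hfnn y))
    rcases (mul_nonneg (hfnn x') (hfnn' x)).eq_or_lt with h0 | h0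
    · rw [← h0, zero_mul, add_zero]
      rcases (mul_nonneg (hfnn x) (hfnn' x')).eq_or_lt with h1 | h1
      · rw [← h1, zero_mul]
      · exact mul_nonneg h1.le (sub_nonneg.2 (hA x x' hxx' h1))
    · have h1 := h0.trans_le hdet
      have a := hA x x' hxx' h1
      have b := hlt x x le_rfl (pos_of_mul_pos_left h1 (hfnn' x'))
        (pos_of_mul_pos_right h0 (hfnn x'))
      have d := hlt x' x' le_rfl (pos_of_mul_pos_left h0 (hfnn' x))
        (pos_of_mul_pos_right h1 (hfnn x))
      nlinarith [mul_nonneg (sub_nonneg.2 hdet) (sub_nonneg.2 a),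
        mul_nonneg h0.le (add_nonneg (sub_nonneg.2 b) (sub_nonneg.2 d))]
  have hmain : ∫ x, (∫ θ, q x θ ∂μ') * Real.exp (γ * G' x) ∂lam ≤
      ∫ x, (∫ θ, q x θ ∂μ) * Real.exp (γ * G x) ∂lam := by
    have hgood : ∀ᵐ x ∂lam, Integrable (q x) μ ∧ Integrable (q x) μ' :=
      I.prod_right_ae.and I'.prod_right_ae
    have h := integral_mul_integral_le_of_symmetrization hf hg' hg hf' ?_
    · rwa [hone, hone', one_mul, mul_one] at h
    · filter_upwards [Measure.quasiMeasurePreserving_fst.ae hgood,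
        Measure.quasiMeasurePreserving_snd.ae hgood] with z h1 h2
      obtain ⟨x, x'⟩ := z
      dsimp only at h1 h2 ⊢
      rcases le_total x x' with hxx' | hxx'
      · linarith [hsymm x x' hxx' (hle x x' hxx' h1.1 h2.1 h1.2 h2.2)]
      · linarith [hsymm x' x hxx' (hle x' x hxx' h2.1 h1.1 h2.2 h1.2)]
  rw [hoff, hoff', integral_withDensity_ofReal_mul hf.aestronglyMeasurable.aemeasurable hfnn,
    integral_withDensity_ofReal_mul hf'.aestronglyMeasurable.aemeasurable hfnn']
  exact mul_le_mul_of_nonpos_left (Real.log_le_log hpos hmain)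
    (one_div_nonpos.2 hγ.le)

/-- If the density family `q` is MTP₂ and `μ ≤_lr μ'` in the likelihood ratio order (both
having densities `p`, `p'` w.r.t. a common σ-finite measure `ν`), then the reservation
levels of the exponential-utility Bayesian house selling problem satisfy
`x^γ_n(μ) ≤ x^γ_n(μ')` for all `n ≥ 1`: the reservation levels are increasing in the
information (here `resLevel lam q c γ n = x^γ_{n+1}`). -/
theorem resLevel_increasing_in_information
    (lam : Measure ℝ) [SigmaFinite lam] (m M : ℝ) (hmM : m < M)
    (q : ℝ → ℝ → ℝ) (hq : Measurable (Function.uncurry q))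
    (hqnn : ∀ x θ, 0 ≤ q x θ)
    (hqdens : ∀ θ, ∫ x, q x θ ∂lam = 1)
    (hqsupp : ∀ x θ, x ∉ Set.Icc m M → q x θ = 0)
    (c : ℝ) (hc : 0 < c) (γ : ℝ) (hγ : γ < 0)
    (hmeas : ∀ (n : ℕ) (μ : Measure ℝ), IsProbabilityMeasure μ →
      Measurable fun x => resLevel lam q c γ n (bayesUpdate q x μ))
    (hMTP2 : ∀ x x' θ θ', x ≤ x' → θ ≤ θ' → q x' θ * q x θ' ≤ q x θ * q x' θ')
    (ν : Measure ℝ) [SigmaFinite ν]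
    (p p' : ℝ → ℝ) (hp : Measurable p) (hp' : Measurable p')
    (hpnn : ∀ θ, 0 ≤ p θ) (hp'nn : ∀ θ, 0 ≤ p' θ)
    (μ μ' : Measure ℝ) (hμprob : IsProbabilityMeasure μ) (hμ'prob : IsProbabilityMeasure μ')
    (hμ : μ = ν.withDensity fun θ => ENNReal.ofReal (p θ))
    (hμ' : μ' = ν.withDensity fun θ => ENNReal.ofReal (p' θ))
    (hlr : ∀ θ θ', θ ≤ θ' → p θ' * p' θ ≤ p θ * p' θ') :
    ∀ n : ℕ, resLevel lam q c γ n μ ≤ resLevel lam q c γ n μ' := by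
  intro n
  induction n generalizing p p' μ μ' with
  | zero =>
    simp only [resLevel]
    refine add_le_add le_rfl ?_
    exact log_integral_offerMeasure_le hq hqnn hqdens hqsupp hγ hMTP2 hp hp' hpnn hp'nn hμ hμ'
      hlr measurable_id measurable_id (fun _ => le_rfl) (fun _ => le_rfl)
      (fun _ _ h _ _ => h)
  | succ n ih =>
    simp only [resLevel]
    refine add_le_add le_rfl ?_
    refine log_integral_offerMeasure_le hq hqnn hqdens hqsupp hγ hMTP2 hp hp' hpnn hp'nn hμ hμ'
      hlr (measurable_id.max (hmeas n μ hμprob)) (measurable_id.max (hmeas n μ' hμ'prob))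
      (fun _ => le_max_left _ _) (fun _ => le_max_left _ _) fun x x' hxx' hx hx' => ?_
    refine max_le_max hxx' (ih _ _ ?_ ?_ ?_ ?_ _ _
      (isProbabilityMeasure_bayesUpdate hqnn x μ) (isProbabilityMeasure_bayesUpdate hqnn x' μ')
      (bayesUpdate_withDensity hq hp hpnn hμ hx)
      (bayesUpdate_withDensity hq hp' hp'nn hμ' hx') ?_)
    · exact hp.mul (hq.of_uncurry_left.div_const _)
    · exact hp'.mul (hq.of_uncurry_left.div_const _)
    · exact fun θ => mul_nonneg (hpnn θ) (div_nonneg (hqnn x θ) hx.le)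
    · exact fun θ => mul_nonneg (hp'nn θ) (div_nonneg (hqnn x' θ) hx'.le)
    · intro θ θ' h
      have hprod : p θ' * p' θ * (q x' θ * q x θ') ≤ p θ * p' θ' * (q x θ * q x' θ') :=
        mul_le_mul (hlr θ θ' h) (hMTP2 x x' θ θ' hxx' h)
          (mul_nonneg (hqnn _ _) (hqnn _ _)) (mul_nonneg (hpnn _) (hp'nn _))
      have hdiv := div_le_div_of_nonneg_right hprod (mul_pos hx hx').le
      calc _ = _ := by ring
        _ ≤ _ := hdiv
        _ = _ := by ring
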